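/- arXiv:2110.15524 — 4 statements merged into one kernel-verified Lean document; each statement's English description precedes it below -/
import Mathlib

section
/- (Lemma 2: change of dependent variable for the Sturm–Liouville equation.) Let u : [z₀, z₁] → ℝ be continuously differentiable, λ ∈ ℝ, and let v : [z₀, z₁] → ℝ be twice continuously differentiable with v(z) ≠ 0 for all z. If y : [z₀, z₁] → ℝ is twice differentiable, satisfies −(u(z) y′(z))′ = λ y(z) on (z₀, z₁), and ŷ is defined by y(z) = v(z)·ŷ(z), then ŷ satisfies −(u(z) v(z)² ŷ′(z))′ − (u(z) v′(z))′ · v(z) · ŷ(z) = λ v(z)² ŷ(z) for all z ∈ (z₀, z₁). -/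
/-- Lemma 2: change of the dependent variable in the Sturm–Liouville
equation. If `-(u y′)′ = λ y` on `(z₀, z₁)` and `y = v·ŷ` with `v` twice continuously
differentiable and nonvanishing, then
`-(u v² ŷ′)′ - (u v′)′ v ŷ = λ v² ŷ` on `(z₀, z₁)`. -/
theorem stmt_4 (z₀ z₁ lam : ℝ) (hz : z₀ < z₁) (u v y yh : ℝ → ℝ)
    (hu : ContDiffOn ℝ 1 u (Set.Icc z₀ z₁))
    (hv : ContDiffOn ℝ 2 v (Set.Icc z₀ z₁))
    (hvne : ∀ z ∈ Set.Icc z₀ z₁, v z ≠ 0)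
    (hy : ∀ z ∈ Set.Icc z₀ z₁, DifferentiableAt ℝ y z ∧ DifferentiableAt ℝ (deriv y) z)
    (hode : ∀ z ∈ Set.Ioo z₀ z₁, -deriv (fun w => u w * deriv y w) z = lam * y z)
    (hyh : ∀ z, y z = v z * yh z) :
    ∀ z ∈ Set.Ioo z₀ z₁,
      -deriv (fun w => u w * v w ^ 2 * deriv yh w) z
        - deriv (fun w => u w * deriv v w) z * v z * yh z
        = lam * v z ^ 2 * yh z := by
  intro z hz'
  have hv_open : ContDiffOn ℝ 2 v (Set.Ioo z₀ z₁) := hv.mono Set.Ioo_subset_Icc_self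
  have hv_diff : ∀ w ∈ Set.Ioo z₀ z₁, DifferentiableAt ℝ v w := fun w hw =>
    (hv_open.differentiableOn (by norm_num)).differentiableAt (isOpen_Ioo.mem_nhds hw)
  have hu_diff : DifferentiableAt ℝ u z :=
    ((hu.mono Set.Ioo_subset_Icc_self).differentiableOn (by norm_num)).differentiableAt
      (isOpen_Ioo.mem_nhds hz')
  have hdv : DifferentiableAt ℝ (deriv v) z :=
    ((hv_open.deriv_of_isOpen (m := 1) isOpen_Ioo (by norm_num)).differentiableOn
      (by norm_num)).differentiableAt (isOpen_Ioo.mem_nhds hz')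
  have hflux : (fun w => u w * v w ^ 2 * deriv yh w) =ᶠ[nhds z]
      fun w => v w * (u w * deriv y w) - y w * (u w * deriv v w) := by
    filter_upwards [isOpen_Ioo.mem_nhds hz'] with w hw
    have hquot : yh =ᶠ[nhds w] fun x => y x / v x := by
      filter_upwards [isOpen_Ioo.mem_nhds hw] with x hx
      rw [hyh x, mul_div_cancel_left₀ _ (hvne x (Set.Ioo_subset_Icc_self hx))]
    have hvw := hvne w (Set.Ioo_subset_Icc_self hw)
    rw [hquot.deriv_eq,
      deriv_fun_div (hy w (Set.Ioo_subset_Icc_self hw)).1 (hv_diff w hw) hvw]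
    field_simp
  obtain ⟨hy₁, hy₂⟩ := hy z (Set.Ioo_subset_Icc_self hz')
  have hderiv := ((hv_diff z hz').hasDerivAt.mul (hu_diff.mul hy₂).hasDerivAt).sub
    (hy₁.hasDerivAt.mul (hu_diff.mul hdv).hasDerivAt)
  have hflux_deriv : deriv (fun w => u w * v w ^ 2 * deriv yh w) z =
      deriv v z * (u z * deriv y z) + v z * deriv (fun w => u w * deriv y w) z -
        (deriv y z * (u z * deriv v z) + y z * deriv (fun w => u w * deriv v w) z) :=
    hflux.deriv_eq.trans hderiv.deriv
  rw [hflux_deriv]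
  linear_combination v z * hode z hz' +
    (deriv (fun w => u w * deriv v w) z + lam * v z) * hyh z
end

section
/- (Liouville normal form theorem.) Let u : [z₀, z₁] → ℝ be twice continuously differentiable with u(z) > 0 for all z, let λ ∈ ℝ, and let y solve −(u y′)′ = λ y on (z₀, z₁). Define the Liouville transformation: ẑ(z) = ∫_{z₀}^{z} dζ/√(u(ζ)), which is a strictly increasing bijection of [z₀, z₁] onto [0, ẑ₁] with inverse z(ẑ), and set v(ẑ) = u(z(ẑ))^{−1/4} and ŷ(ẑ) = y(z(ẑ)) / v(ẑ). Then ŷ satisfies the Liouville normal (Schrödinger) form −d²ŷ/dẑ² + q(ẑ) ŷ = λ ŷ on (0, ẑ₁), where the invariant function is q(ẑ) = v(ẑ) · d²/dẑ² (1/v(ẑ)). -/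
open Set Filter Topology

/-- If `Z` has derivative `p ∘ Z` on an open set `S` which it maps into `T`, then a function equal
to `f ∘ Z` on `S` has second derivative `((f' p)' p) ∘ Z` there. -/
theorem deriv_deriv_eq_of_eqOn_comp {S T : Set ℝ} (hS : IsOpen S) {Z p f f' h : ℝ → ℝ}
    (hZT : MapsTo Z S T) (hZ : ∀ s ∈ S, HasDerivAt Z (p (Z s)) s)
    (hf : ∀ z ∈ T, HasDerivAt f (f' z) z) (hh : EqOn h (f ∘ Z) S) {s c : ℝ} (hs : s ∈ S)
    (hc : HasDerivAt (fun z => f' z * p z) c (Z s)) :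
    deriv (deriv h) s = c * p (Z s) := by
  have h1 : ∀ t ∈ S, deriv h t = f' (Z t) * p (Z t) := fun t ht =>
    (((hf _ (hZT ht)).comp t (hZ t ht)).congr_of_eventuallyEq
      (hh.eventuallyEq_of_mem (hS.mem_nhds ht))).deriv
  have h2 : deriv h =ᶠ[𝓝 s] (fun z => f' z * p z) ∘ Z := by
    filter_upwards [hS.mem_nhds hs] with t ht using h1 t ht
  exact ((hc.comp s (hZ s hs)).congr_of_eventuallyEq h2).deriv


/-- Liouville normal form: with the Liouville transformation
`ẑ = g z = ∫_{z₀}^z dζ/√(u ζ)`, inverse `Z`, `v = u(Z ·)^{-1/4}` and `ŷ = y(Z ·)/v`,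
the map `g` is a strictly increasing bijection of `[z₀, z₁]` onto `[0, g z₁]` and `ŷ`
satisfies the Schrödinger form `-ŷ″ + q ŷ = λ ŷ` on `(0, g z₁)`, where
`q = v · (1/v)″`. -/
theorem stmt_5 (z₀ z₁ lam : ℝ) (hz : z₀ < z₁) (u y : ℝ → ℝ)
    (hu : ContDiffOn ℝ 2 u (Set.Icc z₀ z₁))
    (hupos : ∀ z ∈ Set.Icc z₀ z₁, 0 < u z)
    (hy : ∀ z ∈ Set.Icc z₀ z₁, DifferentiableAt ℝ y z ∧ DifferentiableAt ℝ (deriv y) z)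
    (hode : ∀ z ∈ Set.Ioo z₀ z₁, -deriv (fun w => u w * deriv y w) z = lam * y z)
    (g : ℝ → ℝ) (hg : ∀ z, g z = ∫ ζ in z₀..z, 1 / Real.sqrt (u ζ))
    (Z : ℝ → ℝ) (hZmem : ∀ zh ∈ Set.Icc 0 (g z₁), Z zh ∈ Set.Icc z₀ z₁)
    (hZg : ∀ z ∈ Set.Icc z₀ z₁, Z (g z) = z)
    (v yh q : ℝ → ℝ)
    (hv : ∀ zh, v zh = u (Z zh) ^ (-(1 / 4 : ℝ)))
    (hyhdef : ∀ zh, yh zh = y (Z zh) / v zh)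
    (hq : ∀ zh, q zh = v zh * deriv (deriv (fun s => 1 / v s)) zh) :
    StrictMonoOn g (Set.Icc z₀ z₁) ∧
    g '' Set.Icc z₀ z₁ = Set.Icc 0 (g z₁) ∧
    ∀ zh ∈ Set.Ioo 0 (g z₁),
      -deriv (deriv yh) zh + q zh * yh zh = lam * yh zh := by
  have hcont : ContinuousOn (fun ζ => 1 / Real.sqrt (u ζ)) (Icc z₀ z₁) :=
    continuousOn_const.div hu.continuousOn.sqrt fun z hz => (Real.sqrt_pos.2 (hupos z hz)).ne'
  have hg0 : g z₀ = 0 := by simp [hg]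
  have hgfun : g = fun z => ∫ ζ in z₀..z, 1 / Real.sqrt (u ζ) := funext hg
  have hgcont : ContinuousOn g (Icc z₀ z₁) := by
    rw [hgfun]
    rw [← uIcc_of_le hz.le] at hcont ⊢
    exact intervalIntegral.continuousOn_primitive_interval
      (hcont.integrableOn_compact isCompact_uIcc)
  have hgderiv : ∀ z ∈ Ioo z₀ z₁, HasStrictDerivAt g (1 / Real.sqrt (u z)) z := by
    intro z hzI
    rw [hgfun]
    have hnhds : Icc z₀ z₁ ∈ 𝓝 z := Icc_mem_nhds hzI.1 hzI.2
    refine intervalIntegral.integral_hasStrictDerivAt_right ?_ ?_ (hcont.continuousAt hnhds)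
    · exact (hcont.mono (Icc_subset_Icc_right hzI.2.le)).intervalIntegrable_of_Icc hzI.1.le
    · exact (hcont.mono Ioo_subset_Icc_self).stronglyMeasurableAtFilter isOpen_Ioo z hzI
  have hgmono : StrictMonoOn g (Icc z₀ z₁) := by
    refine strictMonoOn_of_deriv_pos (convex_Icc _ _) hgcont fun z hzI => ?_
    rw [interior_Icc] at hzI
    rw [(hgderiv z hzI).hasDerivAt.deriv]
    exact one_div_pos.2 (Real.sqrt_pos.2 (hupos z (Ioo_subset_Icc_self hzI)))
  have hgimage : g '' Icc z₀ z₁ = Icc 0 (g z₁) := by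
    rw [← hg0]
    refine Subset.antisymm ?_ (intermediate_value_Icc hz.le hgcont)
    rintro _ ⟨z, hzI, rfl⟩
    exact ⟨hgmono.monotoneOn (left_mem_Icc.2 hz.le) hzI hzI.1,
      hgmono.monotoneOn hzI (right_mem_Icc.2 hz.le) hzI.2⟩
  refine ⟨hgmono, hgimage, ?_⟩
  have hinv : ∀ s ∈ Ioo 0 (g z₁), Z s ∈ Ioo z₀ z₁ ∧ g (Z s) = s := by
    intro s hs
    obtain ⟨z, hzI, rfl⟩ := hgimage.ge (Ioo_subset_Icc_self hs)
    rw [hZg z hzI]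
    refine ⟨⟨hzI.1.lt_of_ne ?_, hzI.2.lt_of_ne ?_⟩, rfl⟩
    · rintro rfl; exact hs.1.ne' hg0
    · rintro rfl; exact hs.2.false
  set w : ℝ → ℝ := fun z => u z ^ (1 / 4 : ℝ) with hw
  have hwpos : ∀ z ∈ Icc z₀ z₁, 0 < w z := fun z hzI => Real.rpow_pos_of_pos (hupos z hzI) _
  have hw4 : ∀ z ∈ Icc z₀ z₁, u z = w z ^ 4 := by
    intro z hzI
    simp only [hw]
    rw [← Real.rpow_mul_natCast (hupos z hzI).le]
    norm_num
  have hw2 : ∀ z ∈ Icc z₀ z₁, Real.sqrt (u z) = w z ^ 2 := by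
    intro z hzI
    rw [hw4 z hzI, show w z ^ 4 = (w z ^ 2) ^ 2 by ring, Real.sqrt_sq (sq_nonneg _)]
  have hZderiv : ∀ s ∈ Ioo 0 (g z₁), HasDerivAt Z (w (Z s) ^ 2) s := by
    intro s hs
    obtain ⟨hZs, hgZ⟩ := hinv s hs
    have hZI := Ioo_subset_Icc_self hZs
    have h := (hgderiv _ hZs).to_local_left_inverse (g := Z)
      (one_div_pos.2 (Real.sqrt_pos.2 (hupos _ hZI))).ne'
      (eventually_of_mem (Icc_mem_nhds hZs.1 hZs.2) hZg)
    rw [hgZ, one_div, inv_inv, hw2 _ hZI] at h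
    exact h.hasDerivAt
  have hwC : ∀ z ∈ Ioo z₀ z₁, ContDiffAt ℝ 2 w z := fun z hzI =>
    (hu.contDiffAt (Icc_mem_nhds hzI.1 hzI.2)).rpow_const_of_ne
      (hupos z (Ioo_subset_Icc_self hzI)).ne'
  have hwd : ∀ z ∈ Ioo z₀ z₁, HasDerivAt w (deriv w z) z := fun z hzI =>
    ((hwC z hzI).differentiableAt (by norm_num)).hasDerivAt
  have hwdd : ∀ z ∈ Ioo z₀ z₁, HasDerivAt (deriv w) (deriv (deriv w) z) z := fun z hzI =>
    (((hwC z hzI).derivWithin (m := 1) (by norm_num)).differentiableAt (by norm_num)).hasDerivAt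
  have hyd : ∀ z ∈ Ioo z₀ z₁, HasDerivAt y (deriv y z) z := fun z hzI =>
    (hy z (Ioo_subset_Icc_self hzI)).1.hasDerivAt
  have hydd : ∀ z ∈ Ioo z₀ z₁, HasDerivAt (deriv y) (deriv (deriv y) z) z := fun z hzI =>
    (hy z (Ioo_subset_Icc_self hzI)).2.hasDerivAt
  have hvw : ∀ s ∈ Ioo 0 (g z₁), v s = (w (Z s))⁻¹ := fun s hs => by
    rw [hv, Real.rpow_neg (hupos _ (Ioo_subset_Icc_self (hinv s hs).1)).le]
  intro s hs
  have hZs := (hinv s hs).1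
  have hZI := Ioo_subset_Icc_self hZs
  have hmaps : MapsTo Z (Ioo 0 (g z₁)) (Ioo z₀ z₁) := fun t ht => (hinv t ht).1
  have hode' := hode _ hZs
  have huy : (fun z => u z * deriv y z) =ᶠ[𝓝 (Z s)] fun z => w z ^ 4 * deriv y z := by
    filter_upwards [Icc_mem_nhds hZs.1 hZs.2] with z hzI
    rw [hw4 z hzI]
  have hflux : HasDerivAt (fun z => w z ^ 4 * deriv y z) _ (Z s) :=
    ((hwd _ hZs).pow 4).mul (hydd _ hZs)
  rw [huy.deriv_eq, hflux.deriv] at hode'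
  have hinvv := deriv_deriv_eq_of_eqOn_comp (p := fun z => w z ^ 2) (h := fun s => 1 / v s)
    isOpen_Ioo hmaps hZderiv hwd
    (fun t ht => by simp [hvw t ht]) hs ((hwdd _ hZs).mul ((hwd _ hZs).pow 2))
  have hyhat := deriv_deriv_eq_of_eqOn_comp (p := fun z => w z ^ 2) (h := yh)
    isOpen_Ioo hmaps hZderiv (fun z hzI => (hwd z hzI).mul (hyd z hzI))
    (fun t ht => by simp [hyhdef, hvw t ht, mul_comm]) hs
    ((((hwdd _ hZs).mul (hyd _ hZs)).add ((hwd _ hZs).mul (hydd _ hZs))).mul ((hwd _ hZs).pow 2))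
  have hne := (hwpos _ hZI).ne'
  rw [hq, hyhat, hinvv, hyhdef, hvw s hs]
  simp only [Pi.pow_apply, Pi.mul_apply, Pi.add_apply] at hode' ⊢
  field_simp
  push_cast at hode' ⊢
  linear_combination hode'
end

section
/- (Corollary 1, part 1: convergence to the steady state.) Let (λₙ)_{n≥0} be a sequence of reals with 0 < λ₀ ≤ λₙ for all n, let (aₙ) be reals, let yₙ : [z₀, z₁] → ℝ be functions with Mₙ = sup_{z∈[z₀,z₁]} |aₙ yₙ(z)| < ∞, and assume Σ_{n=0}^{∞} Mₙ e^{−λₙ t₀} < ∞ for some t₀ > 0. Define θ(z, t) = θ̄(z) + Σ_{n=0}^{∞} aₙ yₙ(z) e^{−λₙ t} for t ≥ t₀. Then sup_{z∈[z₀,z₁]} |θ(z, t) − θ̄(z)| ≤ e^{−λ₀ (t − t₀)} · Σ_{n=0}^{∞} Mₙ e^{−λₙ t₀} for all t ≥ t₀; in particular θ(·, t) converges uniformly to θ̄ on [z₀, z₁] as t → ∞. -/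
open Filter

/-- Corollary 1, part 1: convergence to the steady state. With
`0 < λ₀ ≤ λₙ`, `|aₙ yₙ(z)| ≤ Mₙ` on `[z₀, z₁]` and `Σ Mₙ e^{-λₙ t₀} < ∞`, the series
solution `θ(z,t) = θ̄(z) + Σ aₙ yₙ(z) e^{-λₙ t}` satisfies
`sup_z |θ(z,t) - θ̄(z)| ≤ e^{-λ₀(t-t₀)} Σ Mₙ e^{-λₙ t₀}` for `t ≥ t₀`; in particular
`θ(·,t) → θ̄` uniformly on `[z₀, z₁]` as `t → ∞`. -/
theorem stmt_6 (z₀ z₁ t₀ : ℝ) (ht₀ : 0 < t₀)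
    (lam : ℕ → ℝ) (a : ℕ → ℝ) (y : ℕ → ℝ → ℝ) (M : ℕ → ℝ) (θbar : ℝ → ℝ)
    (hlam0 : 0 < lam 0) (hlam : ∀ n, lam 0 ≤ lam n)
    (hM : ∀ n, ∀ z ∈ Set.Icc z₀ z₁, |a n * y n z| ≤ M n)
    (hsum : Summable fun n => M n * Real.exp (-lam n * t₀))
    (θ : ℝ → ℝ → ℝ)
    (hθ : ∀ z t, θ z t = θbar z + ∑' n, a n * y n z * Real.exp (-lam n * t)) :
    (∀ t ≥ t₀, ∀ z ∈ Set.Icc z₀ z₁,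
      |θ z t - θbar z| ≤ Real.exp (-lam 0 * (t - t₀)) * ∑' n, M n * Real.exp (-lam n * t₀)) ∧
    TendstoUniformlyOn (fun t z => θ z t) θbar atTop (Set.Icc z₀ z₁) := by
  have bound : ∀ t ≥ t₀, ∀ z ∈ Set.Icc z₀ z₁, |θ z t - θbar z| ≤
      Real.exp (-lam 0 * (t - t₀)) * ∑' n, M n * Real.exp (-lam n * t₀) := by
    intro t ht z hz
    rw [hθ, add_sub_cancel_left, ← Real.norm_eq_abs]
    refine tsum_of_norm_bounded (hsum.hasSum.mul_left _) fun n => ?_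
    rw [Real.norm_eq_abs, abs_mul, Real.abs_exp, mul_left_comm, ← Real.exp_add]
    have hexp : -lam n * t ≤ -lam 0 * (t - t₀) + -lam n * t₀ := by
      nlinarith [mul_nonneg (sub_nonneg.2 (hlam n)) (sub_nonneg.2 ht)]
    exact mul_le_mul (hM n z hz) (Real.exp_le_exp.2 hexp) (Real.exp_nonneg _)
      ((abs_nonneg _).trans (hM n z hz))
  refine ⟨bound, Metric.tendstoUniformlyOn_iff.2 fun ε hε => ?_⟩
  have hlim : Tendsto (fun t => Real.exp (-lam 0 * (t - t₀)) *
      ∑' n, M n * Real.exp (-lam n * t₀)) atTop (nhds 0) := by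
    have hlin : Tendsto (fun t => -lam 0 * (t - t₀)) atTop atBot :=
      (tendsto_atTop_add_const_right _ (-t₀) tendsto_id).const_mul_atTop_of_neg
        (neg_lt_zero.2 hlam0)
    simpa using (Real.tendsto_exp_atBot.comp hlin).mul_const
      (∑' n, M n * Real.exp (-lam n * t₀))
  filter_upwards [hlim.eventually_lt_const hε, eventually_ge_atTop t₀] with t hlt ht z hz
  rw [dist_comm, Real.dist_eq]
  exact (bound t ht z hz).trans_lt hlt
end

section
/- (Exact landscape function of the second PdHA problem.) Let φ = (1 + √5)/2, and define C₁ = (1/100)·[ (10π + 1)² − (10π + 1)^{1−φ} ] / [ (10π + 1)^{φ} − (10π + 1)^{1−φ} ] and C₂ = (1/100)·[ (10π + 1)^{φ} − (10π + 1)² ] / [ (10π + 1)^{φ} − (10π + 1)^{1−φ} ]. Then the function v(ẑ) = C₁ (10ẑ + 1)^{φ} + C₂ (10ẑ + 1)^{1−φ} − ẑ² − ẑ/5 − 1/100 satisfies −v″(ẑ) + v(ẑ)/(ẑ + 1/10)² = 1 for all ẑ ∈ (0, π), together with the Dirichlet boundary conditions v(0) = 0 and v(π) = 0. -/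
theorem hasDerivAt_affine_rpow (p : ℝ) {x : ℝ} (hx : 0 < 10 * x + 1) :
    HasDerivAt (fun y : ℝ => (10 * y + 1) ^ p) (10 * p * (10 * x + 1) ^ (p - 1)) x := by
  have h : HasDerivAt (fun y : ℝ => 10 * y + 1) 10 x := by
    simpa using ((hasDerivAt_id x).const_mul 10).add_const 1
  exact (h.rpow_const (Or.inl hx.ne')).congr_deriv (by ring)


/-- exact landscape function of the second PdHA problem: with
`φ = (1+√5)/2` and the stated constants `C₁, C₂`, the function
`v ẑ = C₁(10ẑ+1)^φ + C₂(10ẑ+1)^{1−φ} − ẑ² − ẑ/5 − 1/100` satisfies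
`-v″ + v/(ẑ+1/10)² = 1` on `(0, π)` with `v 0 = 0 = v π`. -/
theorem stmt_16 (φ C₁ C₂ : ℝ) (hφ : φ = (1 + Real.sqrt 5) / 2)
    (hC₁ : C₁ = 1 / 100 * (((10 * Real.pi + 1) ^ (2 : ℝ) - (10 * Real.pi + 1) ^ (1 - φ)) /
      ((10 * Real.pi + 1) ^ φ - (10 * Real.pi + 1) ^ (1 - φ))))
    (hC₂ : C₂ = 1 / 100 * (((10 * Real.pi + 1) ^ φ - (10 * Real.pi + 1) ^ (2 : ℝ)) /
      ((10 * Real.pi + 1) ^ φ - (10 * Real.pi + 1) ^ (1 - φ))))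
    (v : ℝ → ℝ)
    (hv : ∀ zh, v zh = C₁ * (10 * zh + 1) ^ φ + C₂ * (10 * zh + 1) ^ (1 - φ)
      - zh ^ 2 - zh / 5 - 1 / 100) :
    (∀ zh ∈ Set.Ioo 0 Real.pi,
      -deriv (deriv v) zh + v zh / (zh + 1 / 10) ^ 2 = 1) ∧
    v 0 = 0 ∧ v Real.pi = 0 := by
  have hv' : v = fun z => C₁ * (10 * z + 1) ^ φ + C₂ * (10 * z + 1) ^ (1 - φ)
      - z ^ 2 - z / 5 - 1 / 100 := funext hv
  have hφ_sq : φ ^ 2 = φ + 1 := by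
    have h5 := Real.sq_sqrt (show (0 : ℝ) ≤ 5 by norm_num)
    rw [hφ]
    linear_combination h5 / 4
  have hφ_half : 1 - φ < φ := by
    have h5 : 0 < Real.sqrt 5 := by positivity
    linarith
  have hπ := Real.pi_pos
  have hden : (10 * Real.pi + 1) ^ φ - (10 * Real.pi + 1) ^ (1 - φ) ≠ 0 :=
    (sub_pos.2 (Real.rpow_lt_rpow_of_exponent_lt (by linarith) hφ_half)).ne'
  refine ⟨fun z hz => ?_, ?_, ?_⟩
  · have hd : ∀ y : ℝ, 0 < y → HasDerivAt v
        (C₁ * (10 * φ * (10 * y + 1) ^ (φ - 1)) +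
          C₂ * (10 * (1 - φ) * (10 * y + 1) ^ (1 - φ - 1)) - 2 * y - 1 / 5) y := by
      intro y hy
      have hy' : 0 < 10 * y + 1 := by linarith
      rw [hv']
      refine ((((((hasDerivAt_affine_rpow φ hy').const_mul C₁).add
        ((hasDerivAt_affine_rpow (1 - φ) hy').const_mul C₂)).sub
        (hasDerivAt_pow 2 y)).sub ((hasDerivAt_id y).div_const 5)).sub_const
        (1 / 100)).congr_deriv ?_
      norm_num
    have hz0 : 0 < z := hz.1
    have ht : 0 < 10 * z + 1 := by linarith
    have heq : deriv v =ᶠ[nhds z] fun y => C₁ * (10 * φ * (10 * y + 1) ^ (φ - 1)) +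
        C₂ * (10 * (1 - φ) * (10 * y + 1) ^ (1 - φ - 1)) - 2 * y - 1 / 5 := by
      filter_upwards [lt_mem_nhds hz0] with y hy using (hd y hy).deriv
    have hdd : deriv (deriv v) z =
        C₁ * (10 * φ * (10 * (φ - 1) * (10 * z + 1) ^ (φ - 1 - 1))) +
        C₂ * (10 * (1 - φ) * (10 * (1 - φ - 1) * (10 * z + 1) ^ (1 - φ - 1 - 1))) - 2 := by
      rw [heq.deriv_eq]
      refine (((((((hasDerivAt_affine_rpow (φ - 1) ht).const_mul (10 * φ)).const_mul C₁).add
        (((hasDerivAt_affine_rpow (1 - φ - 1) ht).const_mul (10 * (1 - φ))).const_mul C₂)).sub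
        ((hasDerivAt_id z).const_mul 2)).sub_const (1 / 5)).congr_deriv ?_).deriv
      norm_num
    rw [hdd, hv, Real.rpow_sub_one ht.ne', Real.rpow_sub_one ht.ne',
      Real.rpow_sub_one ht.ne' (1 - φ - 1), Real.rpow_sub_one ht.ne' (1 - φ),
      show z + 1 / 10 = (10 * z + 1) / 10 by ring]
    generalize (10 * z + 1) ^ φ = a
    generalize (10 * z + 1) ^ (1 - φ) = b
    field_simp
    linear_combination (-50000 * (C₁ * a + C₂ * b)) * hφ_sq
  · rw [hv, hC₁, hC₂]
    norm_num
    field_simp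
    ring
  · rw [hv, hC₁, hC₂, Real.rpow_two]
    field_simp
    ring
end
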